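/- Fix α ∈ (0,2), let c_α = ( ∫_ℝ (1−cos t)|t|^{−1−α} dt )^{−1}, and let ξ_1, ξ_2, … be i.i.d. with density g(u) = c_α(1−cos u)/|u|^{1+α}. Let p_n be the density of S_n = (ξ_1+⋯+ξ_n)/n^{1/α}, and let p(x) = (2π)^{−1}∫_ℝ e^{−izx−|z|^α} dz be the symmetric α-stable density. Then there is C > 0 such that for all n large enough: sup_{x∈ℝ} |p_n(x) − p(x)| ≤ C·n^{−1} if 0 < α < 1, and sup_{x∈ℝ} |p_n(x) − p(x)| ≤ C·n^{−(2−α)/α} if 1 ≤ α < 2. -/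

import Mathlib

open MeasureTheory Real Set Filter

/-- The `n`-fold convolution power of a measure on `ℝ` (law of a sum of `n` i.i.d. copies). -/
noncomputable def convPow (μ : MeasureTheory.Measure ℝ) : ℕ → MeasureTheory.Measure ℝ
  | 0 => MeasureTheory.Measure.dirac 0
  | n + 1 => MeasureTheory.Measure.map (fun p : ℝ × ℝ => p.1 + p.2) ((convPow μ n).prod μ)

open FourierTransform in
theorem fourier_smul_eq_of_integrable {f g : ℝ → ℂ} (hf : Integrable f) (hg : Integrable g) :
    ∫ ξ, 𝓕 f ξ • g ξ = ∫ x, f x • 𝓕 g x := by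
  simpa using! VectorFourier.integral_fourierIntegral_smul_eq_flip (L := innerₗ ℝ)
    continuous_fourierChar continuous_inner hf hg

open FourierTransform in
theorem ae_eq_fourierInv_fourier {g : ℝ → ℂ} (hg : Integrable g) (hG : Integrable (𝓕 g)) :
    g =ᵐ[volume] 𝓕⁻ (𝓕 g) := by
  have hcont : Continuous (𝓕⁻ (𝓕 g)) := by
    rw [fourierInv_eq_fourier_comp_neg]
    exact VectorFourier.fourierIntegral_continuous (L := innerₗ ℝ)
      continuous_fourierChar continuous_inner hG.comp_neg
  refine ae_eq_of_integral_contDiff_smul_eq hg.locallyIntegrable hcont.locallyIntegrable ?_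
  intro f hf hfc
  have h₁ : HasCompactSupport (Complex.ofRealCLM ∘ f) := hfc.comp_left rfl
  have h₂ : ContDiff ℝ (⊤ : ℕ∞) (Complex.ofRealCLM ∘ f) := by fun_prop
  set F : SchwartzMap ℝ ℂ := h₁.toSchwartzMap h₂ with hF
  have hFf : ∀ x, F x = (f x : ℂ) := fun x => rfl
  have hsm : ∀ (h : ℝ → ℂ), ∫ x, f x • h x = ∫ x, F x • h x := by
    intro h
    simp [hFf]
  rw [hsm, hsm]
  have e1 : ∫ x, F x • g x = ∫ x, (𝓕⁻ F) x • 𝓕 g x := by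
    rw [← fourier_smul_eq_of_integrable (𝓕⁻ F).integrable hg, ← SchwartzMap.fourier_coe,
      FourierTransform.fourier_fourierInv_eq]
  have e2 : ∫ x, F x • 𝓕⁻ (𝓕 g) x = ∫ x, (𝓕⁻ F) x • 𝓕 g x := by
    rw [fourierInv_eq_fourier_comp_neg, ← fourier_smul_eq_of_integrable F.integrable hG.comp_neg,
      ← integral_neg_eq_self]
    simp only [neg_neg, SchwartzMap.fourierInv_coe]
    simp only [fourierInv_eq_fourier_neg]
  rw [e1, e2]

open FourierTransform in
theorem eq_withDensity_of_integrable_charFun (ν : Measure ℝ) [IsProbabilityMeasure ν]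
    (hν : ν ≪ volume) (hint : Integrable (charFun ν)) :
    ν = volume.withDensity fun x : ℝ => ENNReal.ofReal
      (((2 * π : ℝ)⁻¹ : ℂ) * ∫ z : ℝ, Complex.exp (-(Complex.I * (z : ℂ) * (x : ℂ))) * charFun ν z).re := by
  set g : ℝ → ℂ := fun x => ((ν.rnDeriv volume x).toReal : ℂ) with hg
  have hgi : Integrable g := Measure.integrable_toReal_rnDeriv.ofReal
  have hFg : ∀ w, 𝓕 g w = charFun ν (-2 * π * w) := by
    intro w
    rw [fourier_real_eq_integral_exp_smul, charFun_apply_real,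
      ← integral_rnDeriv_smul hν]
    congr 1 with x
    simp only [hg, Complex.real_smul, smul_eq_mul]
    rw [mul_comm]
    congr 2
    push_cast; ring
  have hpi : (-2 * π : ℝ) ≠ 0 := by have := pi_pos; simp [this.ne']
  have hGi : Integrable (𝓕 g) := by
    rw [funext hFg]
    exact hint.comp_mul_left' hpi
  have hae := ae_eq_fourierInv_fourier hgi hGi
  conv_lhs => rw [← Measure.withDensity_rnDeriv_eq ν volume hν]
  refine withDensity_congr_ae ?_
  filter_upwards [hae, ν.rnDeriv_lt_top volume] with x hx hlt
  have key : 𝓕⁻ (𝓕 g) x = ((2 * π : ℝ)⁻¹ : ℂ) *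
      ∫ z : ℝ, Complex.exp (-(Complex.I * (z : ℂ) * (x : ℂ))) * charFun ν z := by
    have := Measure.integral_comp_mul_left
      (fun z : ℝ => Complex.exp (-(Complex.I * (z : ℂ) * (x : ℂ))) * charFun ν z) (-2 * π)
    rw [fourierInv_eq']
    have e : |(-2 * π : ℝ)⁻¹| = (2 * π)⁻¹ := by
      rw [abs_inv, neg_mul, abs_neg, abs_of_pos (by positivity)]
    rw [e, Complex.real_smul, Complex.ofReal_inv] at this
    rw [← this]
    congr 1 with v
    rw [hFg, smul_eq_mul]
    congr 2
    simp
    ring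
  rw [← key, ← hx]
  simp [hg, ENNReal.ofReal_toReal hlt.ne]

open Measure in
theorem convPow_succ (μ : Measure ℝ) (n : ℕ) : convPow μ (n + 1) = convPow μ n ∗ μ := rfl

instance isProbabilityMeasure_convPow (μ : Measure ℝ) [IsProbabilityMeasure μ] (n : ℕ) :
    IsProbabilityMeasure (convPow μ n) := by
  induction n with
  | zero => rw [convPow]; infer_instance
  | succ n ih => rw [convPow_succ]; infer_instance

theorem charFun_convPow (μ : Measure ℝ) [IsProbabilityMeasure μ] (n : ℕ) (t : ℝ) :
    charFun (convPow μ n) t = charFun μ t ^ n := by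
  induction n with
  | zero => simp [convPow]
  | succ n ih => rw [convPow_succ, charFun_conv, ih, pow_succ]

theorem convPow_absolutelyContinuous {μ : Measure ℝ} [IsProbabilityMeasure μ]
    (hμ : μ ≪ volume) {n : ℕ} (hn : n ≠ 0) : convPow μ n ≪ volume := by
  obtain ⟨k, rfl⟩ := Nat.exists_eq_succ_of_ne_zero hn
  exact Measure.conv_absolutelyContinuous hμ

theorem map_div_absolutelyContinuous {ν : Measure ℝ} (hν : ν ≪ volume) {b : ℝ} (hb : b ≠ 0) :
    ν.map (fun x => x / b) ≪ volume := by
  refine (hν.map (by fun_prop)).trans ?_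
  simp_rw [div_eq_inv_mul]
  rw [Real.map_volume_mul_left (inv_ne_zero hb)]
  exact Measure.smul_absolutelyContinuous

theorem charFun_map_div (ν : Measure ℝ) (b t : ℝ) :
    charFun (ν.map (fun x => x / b)) t = charFun ν (t / b) := by
  simp_rw [div_eq_inv_mul]
  exact charFun_map_mul _ _

/-- The function `(|z+1|^α + |z-1|^α)/2 - |z|^α`. -/
noncomputable def secondDiff (α z : ℝ) : ℝ := (|z + 1| ^ α + |z - 1| ^ α) / 2 - |z| ^ α

theorem integrable_comp_abs {f : ℝ → ℝ} (hf : IntegrableOn f (Ioi 0)) :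
    Integrable (fun x => f |x|) := by
  have := (integrable_fun_norm_addHaar (volume : Measure ℝ) (f := f)).2 (by simpa using hf)
  simpa only [norm_eq_abs] using this

theorem integrable_one_sub_cos_div {α : ℝ} (h0 : 0 < α) (h2 : α < 2) :
    Integrable (fun t : ℝ => (1 - cos t) / |t| ^ (1 + α)) := by
  have hm : AEStronglyMeasurable (fun t : ℝ => (1 - cos t) / |t| ^ (1 + α)) volume := by
    apply Measurable.aestronglyMeasurable; fun_prop
  have hIoi : IntegrableOn (fun t : ℝ => (1 - cos t) / |t| ^ (1 + α)) (Ioi 0) := by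
    rw [← Ioc_union_Ioi_eq_Ioi (zero_le_one' ℝ)]
    refine IntegrableOn.union ?_ ?_
    · have : IntegrableOn (fun t : ℝ => t ^ (1 - α)) (Ioc 0 1) :=
        (intervalIntegrable_iff_integrableOn_Ioc_of_le zero_le_one).1
          (intervalIntegral.intervalIntegrable_rpow' (by linarith))
      refine Integrable.mono' this hm.restrict ?_
      refine (ae_restrict_iff' measurableSet_Ioc).2 (Eventually.of_forall fun t ht => ?_)
      have ht0 : 0 < t := ht.1
      rw [norm_of_nonneg (div_nonneg (by linarith [cos_le_one t]) (by positivity)),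
        abs_of_pos ht0, div_le_iff₀ (by positivity), ← rpow_add ht0,
        show 1 - α + (1 + α) = ((2 : ℕ) : ℝ) by push_cast; ring, rpow_natCast]
      have := one_sub_sq_div_two_le_cos (x := t)
      nlinarith
    · have : IntegrableOn (fun t : ℝ => 2 * t ^ (-(1 + α))) (Ioi 1) :=
        (integrableOn_Ioi_rpow_of_lt (by linarith) zero_lt_one).const_mul 2
      refine Integrable.mono' this hm.restrict ?_
      refine (ae_restrict_iff' measurableSet_Ioi).2 (Eventually.of_forall fun t ht => ?_)
      have ht0 : 0 < t := zero_lt_one.trans ht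
      rw [norm_of_nonneg (div_nonneg (by linarith [cos_le_one t]) (by positivity)),
        abs_of_pos ht0, rpow_neg ht0.le, div_eq_mul_inv]
      gcongr
      linarith [neg_one_le_cos t]
  have := integrable_comp_abs hIoi
  simpa only [cos_abs, abs_abs] using this

theorem integral_one_sub_cos_mul_div {α : ℝ} (h0 : 0 < α) (z : ℝ) :
    ∫ t : ℝ, (1 - cos (z * t)) / |t| ^ (1 + α) =
      |z| ^ α * ∫ t : ℝ, (1 - cos t) / |t| ^ (1 + α) := by
  rcases eq_or_ne z 0 with rfl | hz
  · simp [zero_rpow h0.ne']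
  · have h := Measure.integral_comp_mul_left (fun t : ℝ => (1 - cos t) / |t| ^ (1 + α)) z
    have hz' : 0 < |z| := abs_pos.2 hz
    have e : ∀ t : ℝ, (1 - cos (z * t)) / |t| ^ (1 + α) =
        |z| ^ (1 + α) * ((1 - cos (z * t)) / |z * t| ^ (1 + α)) := by
      intro t
      rw [abs_mul, mul_rpow (abs_nonneg _) (abs_nonneg _)]
      have : |z| ^ (1 + α) ≠ 0 := (rpow_pos_of_pos hz' _).ne'
      field_simp
    simp_rw [e]
    rw [integral_const_mul, h, smul_eq_mul, abs_inv, rpow_add hz', rpow_one]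
    field_simp

theorem integrable_one_sub_cos_mul_div {α : ℝ} (h0 : 0 < α) (h2 : α < 2) (z : ℝ) :
    Integrable (fun t : ℝ => (1 - cos (z * t)) / |t| ^ (1 + α)) := by
  rcases eq_or_ne z 0 with rfl | hz
  · simp
  · have h := ((integrable_one_sub_cos_div h0 h2).comp_mul_left' hz).const_mul (|z| ^ (1 + α))
    refine h.congr (Eventually.of_forall fun t => ?_)
    simp only
    rw [abs_mul, mul_rpow (abs_nonneg _) (abs_nonneg _)]
    have : |z| ^ (1 + α) ≠ 0 := (rpow_pos_of_pos (abs_pos.2 hz) _).ne'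
    field_simp

theorem integral_one_sub_cos_div_pos {α : ℝ} (h0 : 0 < α) (h2 : α < 2) :
    0 < ∫ t : ℝ, (1 - cos t) / |t| ^ (1 + α) := by
  refine (integral_pos_iff_support_of_nonneg
    (fun t => div_nonneg (by linarith [cos_le_one t]) (by positivity))
    (integrable_one_sub_cos_div h0 h2)).2 ?_
  refine lt_of_lt_of_le ?_ (measure_mono (s := Ioo (0 : ℝ) 1) fun t ht => ?_)
  · simp
  · have hc : cos t ≠ 1 := by
      intro h
      have := (cos_eq_one_iff_of_lt_of_lt (by linarith [ht.1, pi_pos])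
        (by linarith [ht.2, pi_gt_three])).1 h
      exact ht.1.ne' this
    have : 0 < |t| ^ (1 + α) := rpow_pos_of_pos (abs_pos.2 ht.1.ne') _
    exact div_ne_zero (sub_ne_zero.2 hc.symm) this.ne'

theorem integral_one_sub_cos_mul_cos_div {α : ℝ} (h0 : 0 < α) (h2 : α < 2) (z : ℝ) :
    Integrable (fun t : ℝ => (1 - cos t) / |t| ^ (1 + α) * cos (z * t)) ∧
    ∫ t : ℝ, (1 - cos t) / |t| ^ (1 + α) * cos (z * t) =
      secondDiff α z * ∫ t : ℝ, (1 - cos t) / |t| ^ (1 + α) := by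
  have e : (fun t : ℝ => (1 - cos t) / |t| ^ (1 + α) * cos (z * t)) = fun t : ℝ =>
      (1 / 2) * ((1 - cos ((z + 1) * t)) / |t| ^ (1 + α)) +
      (1 / 2) * ((1 - cos ((z - 1) * t)) / |t| ^ (1 + α)) -
      (1 - cos (z * t)) / |t| ^ (1 + α) := by
    ext t
    rw [add_mul, sub_mul, one_mul, cos_add, cos_sub]
    ring
  have i := integrable_one_sub_cos_mul_div h0 h2
  have i1 := (i (z + 1)).const_mul (1 / 2)
  have i2 := (i (z - 1)).const_mul (1 / 2)
  rw [e]
  refine ⟨(i1.add i2).sub (i z), ?_⟩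
  rw [integral_sub (by exact i1.add i2) (i z), integral_add i1 i2, integral_const_mul, integral_const_mul]
  simp only [integral_one_sub_cos_mul_div h0, secondDiff]
  ring

/-- The probability measure with density proportional to `(1 - cos u) / |u| ^ (1 + α)`. -/
noncomputable def oscMeasure (α : ℝ) : Measure ℝ := volume.withDensity fun u =>
  ENNReal.ofReal ((∫ t : ℝ, (1 - cos t) / |t| ^ (1 + α))⁻¹ * (1 - cos u) / |u| ^ (1 + α))

theorem integral_oscMeasure {E : Type*} [NormedAddCommGroup E] [NormedSpace ℝ E]
    {α : ℝ} (h0 : 0 < α) (h2 : α < 2) (f : ℝ → E) :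
    ∫ u, f u ∂(oscMeasure α) = (∫ t : ℝ, (1 - cos t) / |t| ^ (1 + α))⁻¹ •
      ∫ u : ℝ, ((1 - cos u) / |u| ^ (1 + α)) • f u := by
  rw [oscMeasure, integral_withDensity_eq_integral_toReal_smul (by fun_prop) (by simp),
    ← integral_smul]
  congr 1 with u
  rw [smul_smul, ENNReal.toReal_ofReal, mul_div_assoc]
  have := integral_one_sub_cos_div_pos h0 h2
  have : 0 ≤ 1 - cos u := by linarith [cos_le_one u]
  positivity

theorem isProbabilityMeasure_oscMeasure {α : ℝ} (h0 : 0 < α) (h2 : α < 2) :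
    IsProbabilityMeasure (oscMeasure α) := by
  constructor
  have hp := integral_one_sub_cos_div_pos h0 h2
  rw [oscMeasure, withDensity_apply _ MeasurableSet.univ, setLIntegral_univ]
  simp_rw [mul_div_assoc]
  rw [← ofReal_integral_eq_lintegral_ofReal ((integrable_one_sub_cos_div h0 h2).const_mul _),
    integral_const_mul, inv_mul_cancel₀ hp.ne', ENNReal.ofReal_one]
  refine Eventually.of_forall fun u => ?_
  have : 0 ≤ 1 - cos u := by linarith [cos_le_one u]
  positivity

theorem integral_cos_oscMeasure {α : ℝ} (h0 : 0 < α) (h2 : α < 2) (z : ℝ) :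
    ∫ u, cos (z * u) ∂(oscMeasure α) = secondDiff α z := by
  rw [integral_oscMeasure h0 h2]
  simp only [smul_eq_mul]
  rw [(integral_one_sub_cos_mul_cos_div h0 h2 z).2, mul_comm, mul_assoc, mul_inv_cancel₀, mul_one]
  exact (integral_one_sub_cos_div_pos h0 h2).ne'

theorem integral_sin_oscMeasure {α : ℝ} (h0 : 0 < α) (h2 : α < 2) (z : ℝ) :
    ∫ u, sin (z * u) ∂(oscMeasure α) = 0 := by
  rw [integral_oscMeasure h0 h2]
  refine smul_eq_zero_of_right _ ?_
  have h := integral_neg_eq_self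
    (fun u : ℝ => ((1 - cos u) / |u| ^ (1 + α)) • sin (z * u)) volume
  simp only [cos_neg, abs_neg, mul_neg, sin_neg, smul_neg, integral_neg] at h
  linarith

theorem charFun_oscMeasure {α : ℝ} (h0 : 0 < α) (h2 : α < 2) (z : ℝ) :
    charFun (oscMeasure α) z = secondDiff α z := by
  have := isProbabilityMeasure_oscMeasure h0 h2
  rw [charFun_apply_real]
  have e : ∀ x : ℝ, Complex.exp (z * x * Complex.I) =
      ((cos (z * x) : ℝ) : ℂ) + ((sin (z * x) : ℝ) : ℂ) * Complex.I := by
    intro x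
    rw [Complex.exp_mul_I]; push_cast; rfl
  simp_rw [e]
  rw [integral_add, integral_mul_const, integral_complex_ofReal, integral_complex_ofReal,
    integral_cos_oscMeasure h0 h2, integral_sin_oscMeasure h0 h2]
  · simp
  · refine Integrable.of_bound (by fun_prop) 1 (Eventually.of_forall fun x => ?_)
    rw [Complex.norm_real]; exact abs_cos_le_one _
  · refine Integrable.of_bound (by fun_prop) 1 (Eventually.of_forall fun x => ?_)
    rw [norm_mul, Complex.norm_real, Complex.norm_I, mul_one]; exact abs_sin_le_one _

theorem ae_abs_cos_mul_lt_one {z : ℝ} (hz : z ≠ 0) : ∀ᵐ u : ℝ, |cos (z * u)| < 1 := by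
  have hc : (range fun k : ℤ => (k : ℝ) * π / z).Countable := countable_range _
  filter_upwards [hc.ae_notMem volume] with u hu
  refine lt_of_le_of_ne (abs_cos_le_one _) fun h => hu ?_
  have hs : sin (z * u) = 0 := by
    have := sin_sq_add_cos_sq (z * u)
    rw [← sq_abs (cos _), h] at this
    nlinarith
  obtain ⟨k, hk⟩ := sin_eq_zero_iff.1 hs
  exact ⟨k, by simp only [hk]; field_simp⟩

theorem abs_secondDiff_lt_one {α : ℝ} (h0 : 0 < α) (h2 : α < 2) {z : ℝ} (hz : z ≠ 0) :
    |secondDiff α z| < 1 := by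
  have := isProbabilityMeasure_oscMeasure h0 h2
  have hae : ∀ᵐ u ∂(oscMeasure α), |cos (z * u)| < 1 :=
    (withDensity_absolutelyContinuous _ _).ae_le (ae_abs_cos_mul_lt_one hz)
  have hi : Integrable (fun u => |cos (z * u)|) (oscMeasure α) := by
    refine Integrable.of_bound (by fun_prop) 1 (Eventually.of_forall fun x => ?_)
    rw [norm_eq_abs, abs_abs]; exact abs_cos_le_one _
  rw [← integral_cos_oscMeasure h0 h2]
  refine abs_integral_le_integral_abs.trans_lt ?_
  have hpos : 0 < ∫ u, (1 - |cos (z * u)|) ∂(oscMeasure α) := by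
    rw [integral_pos_iff_support_of_nonneg (fun u => sub_nonneg.2 (abs_cos_le_one _))
      ((integrable_const _).sub hi)]
    have : Function.support (fun u => 1 - |cos (z * u)|) =ᵐ[oscMeasure α] univ := by
      refine eventuallyEq_univ.2 ?_
      filter_upwards [hae] with u hu
      exact (sub_pos.2 hu).ne'
    rw [measure_congr this]
    simp
  rw [integral_sub (integrable_const _) hi] at hpos
  simpa using hpos

theorem continuous_secondDiff {α : ℝ} (h0 : 0 < α) : Continuous (secondDiff α) := by
  have h : ∀ a : ℝ, Continuous fun z : ℝ => |z + a| ^ α := fun a =>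
    Continuous.rpow_const (by fun_prop) fun _ => Or.inr h0.le
  have h1 := h 1
  have h2 := h (-1)
  have h3 := h 0
  simp only [← sub_eq_add_neg, add_zero] at h2 h3
  unfold secondDiff
  fun_prop

theorem abs_rpow_add_rpow_sub_two_le {α : ℝ} (h0 : 0 < α) (h2 : α < 2) {t : ℝ} (ht : |t| ≤ 1) :
    |(|t + 1| ^ α + |t - 1| ^ α) - 2| ≤ 4 * exp 2 * t ^ 2 := by
  obtain ⟨hl, hu⟩ := abs_le.1 ht
  have ht2 : t ^ 2 ≤ 1 := by nlinarith
  have he : (1 : ℝ) ≤ exp 2 := one_le_exp (by norm_num)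
  rw [abs_of_nonneg (by linarith : 0 ≤ t + 1), abs_sub_comm t 1,
    abs_of_nonneg (by linarith : 0 ≤ 1 - t)]
  rw [abs_le]
  constructor
  · have hprod : (1 - t ^ 2) ^ 2 ≤ (t + 1) ^ α * (1 - t) ^ α := by
      rw [← mul_rpow (by linarith) (by linarith), show (t + 1) * (1 - t) = 1 - t ^ 2 by ring,
        ← rpow_two]
      exact rpow_le_rpow_of_exponent_ge' (by linarith) (by linarith [sq_nonneg t]) h0.le h2.le
    have ha : 0 ≤ (t + 1) ^ α := rpow_nonneg (by linarith) _
    have hb : 0 ≤ (1 - t) ^ α := rpow_nonneg (by linarith) _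
    have hab : 2 * (1 - t ^ 2) ≤ (t + 1) ^ α + (1 - t) ^ α := by
      refine le_of_sq_le_sq ?_ (by positivity)
      nlinarith [sq_nonneg ((t + 1) ^ α - (1 - t) ^ α)]
    nlinarith [sq_nonneg t]
  · have ha : (t + 1) ^ α ≤ exp (α * t) := by
      rw [mul_comm, exp_mul]
      exact rpow_le_rpow (by linarith) (add_one_le_exp t) h0.le
    have hb : (1 - t) ^ α ≤ exp (-(α * t)) := by
      rw [mul_comm, ← neg_mul, exp_mul]
      exact rpow_le_rpow (by linarith) (one_sub_le_exp_neg t) h0.le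
    have hc := cosh_le_exp_half_sq (α * t)
    rw [cosh_eq] at hc
    set s := (α * t) ^ 2 / 2 with hs
    have hs2 : s ≤ 2 * t ^ 2 := by
      have hα : α ^ 2 ≤ 4 := by nlinarith
      rw [hs, mul_pow]
      linarith [mul_le_mul_of_nonneg_right hα (sq_nonneg t)]
    have hexp : exp s - 1 ≤ s * exp s := by
      have h := one_sub_le_exp_neg s
      have h' : exp (-s) * exp s = 1 := by rw [← exp_add]; simp
      nlinarith [exp_pos s]
    have : s * exp s ≤ 2 * t ^ 2 * exp 2 := by
      gcongr
      linarith
    linarith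

theorem abs_secondDiff_sub_le {α : ℝ} (h0 : 0 < α) (h2 : α < 2) {z : ℝ} (hz : |z| ≤ 1) :
    |secondDiff α z - (1 - |z| ^ α)| ≤ 2 * exp 2 * z ^ 2 := by
  have h := abs_rpow_add_rpow_sub_two_le h0 h2 hz
  rw [secondDiff, show ∀ a b : ℝ, a / 2 - b - (1 - b) = (a - 2) / 2 by intros; ring, abs_div,
    abs_two]
  linarith

theorem abs_secondDiff_le_rpow {α : ℝ} (h0 : 0 < α) (h2 : α < 2) {z : ℝ} (hz : 1 ≤ |z|) :
    |secondDiff α z| ≤ 2 * exp 2 * |z| ^ (-(2 - α)) := by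
  have hz0 : 0 < |z| := by linarith
  have hzn : z ≠ 0 := abs_pos.1 hz0
  have h := abs_rpow_add_rpow_sub_two_le h0 h2 (t := z⁻¹) (by
    rw [abs_inv]; exact inv_le_one_of_one_le₀ hz)
  have e : secondDiff α z = |z| ^ α * (((|z⁻¹ + 1| ^ α + |z⁻¹ - 1| ^ α) - 2) / 2) := by
    have e1 : |z + 1| ^ α = |z| ^ α * |z⁻¹ + 1| ^ α := by
      rw [← mul_rpow (abs_nonneg _) (abs_nonneg _), ← abs_mul]
      congr 2; field_simp; ring
    have e2 : |z - 1| ^ α = |z| ^ α * |z⁻¹ - 1| ^ α := by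
      rw [← mul_rpow (abs_nonneg _) (abs_nonneg _), ← abs_mul, ← abs_neg]
      congr 2; field_simp; ring
    rw [secondDiff, e1, e2]; ring
  have hr : |z| ^ (-(2 - α)) = |z| ^ α * z⁻¹ ^ 2 := by
    rw [neg_sub, rpow_sub hz0, rpow_two, sq_abs, div_eq_mul_inv, inv_pow]
  rw [e, hr, abs_mul, abs_of_pos (rpow_pos_of_pos hz0 α), abs_div, abs_two]
  have := rpow_pos_of_pos hz0 α
  nlinarith

theorem abs_secondDiff_le_one {α : ℝ} (h0 : 0 < α) (h2 : α < 2) (z : ℝ) :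
    |secondDiff α z| ≤ 1 := by
  rcases eq_or_ne z 0 with rfl | hz
  · simp [secondDiff, zero_rpow h0.ne']
  · exact (abs_secondDiff_lt_one h0 h2 hz).le

theorem abs_secondDiff_le {α : ℝ} (h0 : 0 < α) (h2 : α < 2) (z : ℝ) :
    |secondDiff α z| ≤ 8 * exp 2 * (1 + |z|) ^ (-(2 - α)) := by
  have he : (1 : ℝ) ≤ exp 2 := one_le_exp (by norm_num)
  have h4 : (1 / 4 : ℝ) ≤ 2 ^ (-(2 - α)) := by
    have : (2 : ℝ) ^ (-2 : ℝ) ≤ 2 ^ (-(2 - α)) :=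
      rpow_le_rpow_of_exponent_le (by norm_num) (by linarith)
    refine le_trans (le_of_eq ?_) this
    rw [rpow_neg (by norm_num), rpow_two]; norm_num
  rcases le_total |z| 1 with hz | hz
  · have : (2 : ℝ) ^ (-(2 - α)) ≤ (1 + |z|) ^ (-(2 - α)) :=
      rpow_le_rpow_of_nonpos (by positivity) (by linarith) (by linarith)
    have h1 := abs_secondDiff_le_one h0 h2 z
    nlinarith
  · have : (2 * |z|) ^ (-(2 - α)) ≤ (1 + |z|) ^ (-(2 - α)) :=
      rpow_le_rpow_of_nonpos (by positivity) (by linarith) (by linarith)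
    rw [mul_rpow (by norm_num) (abs_nonneg _)] at this
    have h1 := abs_secondDiff_le_rpow h0 h2 hz
    have hp : 0 < |z| ^ (-(2 - α)) := rpow_pos_of_pos (by linarith) _
    have : 1 / 4 * |z| ^ (-(2 - α)) ≤ (1 + |z|) ^ (-(2 - α)) := by nlinarith
    nlinarith

theorem integrable_abs_secondDiff_pow {α : ℝ} (h0 : 0 < α) (h2 : α < 2) {m : ℕ}
    (hm : 1 < (2 - α) * m) : Integrable fun z => |secondDiff α z| ^ m := by
  have h := (integrable_one_add_norm (E := ℝ) (μ := volume) (r := (2 - α) * m)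
    (by simpa using hm)).const_mul ((8 * exp 2) ^ m)
  refine h.mono' ((continuous_secondDiff h0).abs.pow m).aestronglyMeasurable
    (Eventually.of_forall fun z => ?_)
  rw [norm_of_nonneg (by positivity), norm_eq_abs, ← neg_mul, rpow_mul (by positivity),
    rpow_natCast, ← mul_pow]
  exact pow_le_pow_left₀ (abs_nonneg _) (abs_secondDiff_le h0 h2 z) m

theorem exists_abs_secondDiff_le_lt_one {α : ℝ} (h0 : 0 < α) (h2 : α < 2) {ε : ℝ} (hε : 0 < ε) :
    ∃ q, 0 < q ∧ q < 1 ∧ ∀ z, ε ≤ |z| → |secondDiff α z| ≤ q := by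
  have htend : Tendsto (fun x : ℝ => 8 * exp 2 * (1 + x) ^ (-(2 - α))) atTop (nhds 0) := by
    rw [← mul_zero (8 * exp 2)]
    exact ((tendsto_rpow_neg_atTop (by linarith)).comp
      (tendsto_atTop_add_const_left _ 1 tendsto_id)).const_mul _
  obtain ⟨R, hR⟩ := eventually_atTop.1 (htend.eventually_le_const (by norm_num : (0 : ℝ) < 1 / 2))
  set S : Set ℝ := {z | ε ≤ |z|} ∩ Metric.closedBall 0 R with hS
  have hSc : IsCompact S :=
    (isCompact_closedBall _ _).inter_left (isClosed_le continuous_const continuous_abs)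
  have hmem : ∀ z, ε ≤ |z| → |z| ≤ R → z ∈ S := fun z h h' => ⟨h, by simpa using h'⟩
  have hlarge : ∀ z, R ≤ |z| → |secondDiff α z| ≤ 1 / 2 := fun z h =>
    (abs_secondDiff_le h0 h2 z).trans (hR _ h)
  rcases S.eq_empty_or_nonempty with he | hne
  · refine ⟨1 / 2, by norm_num, by norm_num, fun z hz => hlarge z ?_⟩
    by_contra! h
    exact (he ▸ hmem z hz h.le : z ∈ (∅ : Set ℝ))
  · obtain ⟨x, hx, hmax⟩ := hSc.exists_isMaxOn hne (continuous_secondDiff h0).abs.continuousOn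
    refine ⟨max (1 / 2) |secondDiff α x|, by positivity,
      max_lt (by norm_num) (abs_secondDiff_lt_one h0 h2 (abs_pos.1 (hε.trans_le hx.1))),
      fun z hz => ?_⟩
    rcases le_total R |z| with h | h
    · exact (hlarge z h).trans (le_max_left _ _)
    · exact (hmax (hmem z hz h)).trans (le_max_right _ _)

theorem exists_abs_secondDiff_pow_sub_exp_le {α : ℝ} (h0 : 0 < α) (h2 : α < 2) :
    ∃ ε > 0, ∀ w, |w| ≤ ε → ∀ n : ℕ, 2 ≤ n →
      |secondDiff α w ^ n - exp (-(n * |w| ^ α))| ≤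
        n * (2 * exp 2 * |w| ^ (2 : ℝ) + |w| ^ (2 * α)) * exp (-(1 / 4 * (n * |w| ^ α))) := by
  have htend : Tendsto (fun x : ℝ => 2 * exp 2 * x ^ (2 - α)) (nhds 0) (nhds 0) := by
    have : Continuous fun x : ℝ => 2 * exp 2 * x ^ (2 - α) :=
      continuous_const.mul (continuous_id.rpow_const fun _ => Or.inr (by linarith))
    simpa [zero_rpow (by linarith : 2 - α ≠ 0)] using this.tendsto 0
  obtain ⟨δ, hδ, hδ'⟩ := Metric.eventually_nhds_iff.1
    (htend.eventually_le_const (by norm_num : (0 : ℝ) < 1 / 2))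
  refine ⟨min (δ / 2) 1, by positivity, fun w hw n hn => ?_⟩
  have hw1 : |w| ≤ 1 := hw.trans (min_le_right _ _)
  set s := |w| ^ α with hs
  have hs0 : 0 ≤ s := by positivity
  have hs1 : s ≤ 1 := rpow_le_one (abs_nonneg _) hw1 h0.le
  have hsmall : 2 * exp 2 * w ^ 2 ≤ s / 2 := by
    have h1 : 2 * exp 2 * |w| ^ (2 - α) ≤ 1 / 2 := by
      refine hδ' ?_
      rw [dist_zero_right, norm_eq_abs, abs_abs]
      linarith [hw.trans (min_le_left _ _)]
    have h3 : w ^ 2 = |w| ^ (2 - α) * s := by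
      rw [hs, ← rpow_add_of_nonneg (abs_nonneg _) (by linarith) h0.le, sub_add_cancel, rpow_two,
        sq_abs]
    rw [h3]
    nlinarith
  have hρ := abs_secondDiff_sub_le h0 h2 hw1
  rw [← hs] at hρ
  have hρ' := abs_le.1 hρ
  have hexp1 : 1 - s / 2 ≤ exp (-(s / 2)) := one_sub_le_exp_neg _
  have hρle : |secondDiff α w| ≤ exp (-(s / 2)) := by
    rw [abs_le]; constructor <;> linarith [hρ'.1, hρ'.2]
  have hb : |exp (-s)| ≤ exp (-(s / 2)) := by
    rw [abs_of_pos (exp_pos _)]; exact exp_le_exp.2 (by linarith)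
  have hdiff : |secondDiff α w - exp (-s)| ≤ 2 * exp 2 * |w| ^ (2 : ℝ) + |w| ^ (2 * α) := by
    have h1 := abs_exp_sub_one_sub_id_le (x := -s) (by rwa [abs_neg, abs_of_nonneg hs0])
    have h3 : |w| ^ (2 * α) = s ^ 2 := by
      rw [mul_comm, rpow_mul (abs_nonneg _), rpow_two]
    rw [h3, rpow_two, sq_abs]
    have h1' := abs_le.1 h1
    rw [abs_le]
    constructor <;> linarith [hρ'.1, hρ'.2, h1'.1, h1'.2, neg_sq s]
  have he : exp (-(n * s)) = exp (-s) ^ n := by rw [← exp_nat_mul]; congr 1; ring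
  rw [he]
  refine (abs_pow_sub_pow_le _ _ _).trans ?_
  have hpow : max |secondDiff α w| |exp (-s)| ^ (n - 1) ≤ exp (-(1 / 4 * (n * s))) := by
    refine (pow_le_pow_left₀ (by positivity) (max_le hρle hb) _).trans ?_
    rw [← exp_nat_mul]
    refine exp_le_exp.2 ?_
    have h2n : (2 : ℝ) ≤ n := by exact_mod_cast hn
    rw [Nat.cast_sub (by omega)]
    push_cast
    nlinarith
  calc _ ≤ (2 * exp 2 * |w| ^ (2 : ℝ) + |w| ^ (2 * α)) * n * exp (-(1 / 4 * (n * s))) := by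
        gcongr
    _ = _ := by ring

theorem integrable_abs_rpow_mul_exp_neg {α s b : ℝ} (h0 : 0 < α) (hs : 0 ≤ s) (hb : 0 < b) :
    Integrable fun z : ℝ => |z| ^ s * exp (-(b * |z| ^ α)) := by
  have h := integrableOn_rpow_mul_exp_neg_mul_rpow (s := s) (p := α) (b := b) (by linarith) h0 hb
  simpa only [neg_mul] using integrable_comp_abs h

theorem eventually_rpow_mul_pow_le (s : ℝ) {q A : ℝ} (hq0 : 0 ≤ q) (hq1 : q < 1) (hA : 0 < A) :
    ∀ᶠ n : ℕ in atTop, (n : ℝ) ^ s * q ^ n ≤ A := by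
  obtain ⟨k, hk⟩ := exists_nat_ge s
  have h := tendsto_pow_const_mul_const_pow_of_abs_lt_one k (r := q) (by rwa [abs_of_nonneg hq0])
  filter_upwards [h.eventually_le_const hA, eventually_ge_atTop 1] with n hn h1
  refine le_trans ?_ hn
  gcongr
  rw [← rpow_natCast]
  exact rpow_le_rpow_of_exponent_le (by exact_mod_cast h1) hk

theorem exists_integral_abs_secondDiff_pow_sub_le {α β : ℝ} (h0 : 0 < α) (h2 : α < 2)
    (hβ1 : β ≤ 1) (hβ2 : β ≤ 2 / α - 1) :
    ∃ C > 0, ∀ᶠ n : ℕ in atTop,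
      Integrable (fun z => secondDiff α (z / (n : ℝ) ^ (1 / α)) ^ n) ∧
      ∫ z, |secondDiff α (z / (n : ℝ) ^ (1 / α)) ^ n - exp (-|z| ^ α)| ≤ C * (n : ℝ) ^ (-β) := by
  obtain ⟨ε, hε, hnear⟩ := exists_abs_secondDiff_pow_sub_exp_le h0 h2
  obtain ⟨q, hq0, hq1, hfar⟩ := exists_abs_secondDiff_le_lt_one h0 h2 hε
  obtain ⟨m, hm⟩ := exists_nat_gt (1 / (2 - α))
  rw [div_lt_iff₀' (by linarith)] at hm
  have hρi := integrable_abs_secondDiff_pow h0 h2 hm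
  set G : ℝ → ℝ := fun z =>
    2 * exp 2 * (|z| ^ (2 : ℝ) * exp (-(1 / 4 * |z| ^ α))) +
      |z| ^ (2 * α) * exp (-(1 / 4 * |z| ^ α)) with hG
  have hGi : Integrable G :=
    ((integrable_abs_rpow_mul_exp_neg h0 (by norm_num) (by norm_num)).const_mul _).add
      (integrable_abs_rpow_mul_exp_neg h0 (by linarith) (by norm_num))
  have hG0 : ∀ z, 0 ≤ G z := fun z => by positivity
  set E : ℝ → ℝ := fun z => exp (-(1 / 2 * |z| ^ α)) with hE
  have hEi : Integrable E := by
    simpa [hE] using integrable_abs_rpow_mul_exp_neg (s := 0) (b := 1 / 2) h0 le_rfl (by norm_num)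
  have hexpi : Integrable fun z : ℝ => exp (-|z| ^ α) := by
    simpa using integrable_abs_rpow_mul_exp_neg (s := 0) (b := 1) h0 le_rfl (by norm_num)
  have hE0 : ∀ z, 0 ≤ E z := fun z => (exp_pos _).le
  set r := exp (-(1 / 2 * ε ^ α)) with hr
  have hr1 : r < 1 := by
    have := rpow_pos_of_pos hε α
    rw [hr]; exact exp_lt_one_iff.2 (by linarith)
  have hiG : 0 ≤ ∫ z, G z := integral_nonneg hG0
  have hiE : 0 ≤ ∫ z, E z := integral_nonneg hE0
  have hiρ : 0 ≤ ∫ z, |secondDiff α z| ^ m := integral_nonneg fun z => by positivity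
  refine ⟨(∫ z, G z) + (∫ z, |secondDiff α z| ^ m) + (∫ z, E z) + 1, by positivity, ?_⟩
  filter_upwards [eventually_rpow_mul_pow_le (1 / α + β) hq0.le hq1 (pow_pos hq0 m),
    eventually_rpow_mul_pow_le β (exp_pos _).le hr1 one_pos, eventually_ge_atTop 2,
    eventually_ge_atTop m] with n hnq hnr hn2 hnm
  have hn0 : (0 : ℝ) < n := by exact_mod_cast (by omega : 0 < n)
  have hn1 : (1 : ℝ) ≤ n := by exact_mod_cast (by omega : 1 ≤ n)
  set b := (n : ℝ) ^ (1 / α) with hb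
  have hb0 : 0 < b := rpow_pos_of_pos hn0 _
  have hρbi : Integrable fun z => |secondDiff α (z / b)| ^ m := hρi.comp_div hb0.ne'
  have hcont : Continuous fun z => secondDiff α (z / b) ^ n :=
    ((continuous_secondDiff h0).comp (continuous_id.div_const b)).pow n
  have hpi : Integrable (fun z => secondDiff α (z / b) ^ n) := by
    refine hρbi.mono' hcont.aestronglyMeasurable (Eventually.of_forall fun z => ?_)
    rw [norm_pow, norm_eq_abs]
    exact pow_le_pow_of_le_one (abs_nonneg _) (abs_secondDiff_le_one h0 h2 _) hnm
  refine ⟨hpi, ?_⟩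
  have hdivrpow : ∀ (z c : ℝ), |z / b| ^ c = |z| ^ c * (n : ℝ) ^ (-(c / α)) := by
    intro z c
    rw [abs_div, abs_of_pos hb0, div_rpow (abs_nonneg _) hb0.le, hb, ← rpow_mul hn0.le,
      rpow_neg hn0.le, div_eq_mul_inv]
    congr 3; ring
  have hscale : ∀ z : ℝ, n * |z / b| ^ α = |z| ^ α := by
    intro z
    rw [hdivrpow, div_self h0.ne', rpow_neg_one]
    field_simp
  have hpt : ∀ z, |secondDiff α (z / b) ^ n - exp (-|z| ^ α)| ≤
      (n : ℝ) ^ (-β) * G z + q ^ (n - m) * |secondDiff α (z / b)| ^ m + r ^ n * E z := by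
    intro z
    rcases le_total |z / b| ε with hz | hz
    · have h := hnear _ hz n hn2
      rw [hscale] at h
      have e1 : n * (2 * exp 2 * |z / b| ^ (2 : ℝ) + |z / b| ^ (2 * α)) ≤
          (n : ℝ) ^ (-β) * (2 * exp 2 * |z| ^ (2 : ℝ) + |z| ^ (2 * α)) := by
        have h2α : 1 < 2 / α := (one_lt_div h0).2 h2
        have f1 : (n : ℝ) * (n : ℝ) ^ (-(2 / α)) ≤ (n : ℝ) ^ (-β) := by
          rw [← rpow_one_add' hn0.le (by linarith)]
          exact rpow_le_rpow_of_exponent_le hn1 (by linarith)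
        have f2 : (n : ℝ) * (n : ℝ) ^ (-(2 * α / α)) ≤ (n : ℝ) ^ (-β) := by
          rw [mul_div_cancel_right₀ _ h0.ne', ← rpow_one_add' hn0.le (by norm_num)]
          exact rpow_le_rpow_of_exponent_le hn1 (by linarith)
        rw [hdivrpow, hdivrpow]
        have g1 := mul_le_mul_of_nonneg_left f1 (by positivity : 0 ≤ 2 * exp 2 * |z| ^ (2 : ℝ))
        have g2 := mul_le_mul_of_nonneg_left f2 (by positivity : 0 ≤ |z| ^ (2 * α))
        linarith
      have e2 := mul_le_mul_of_nonneg_right e1 (exp_pos (-(1 / 4 * |z| ^ α))).le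
      have e3 : 0 ≤ q ^ (n - m) * |secondDiff α (z / b)| ^ m := by positivity
      have e4 : 0 ≤ r ^ n * E z := by positivity
      have e5 : (n : ℝ) ^ (-β) * (2 * exp 2 * |z| ^ (2 : ℝ) + |z| ^ (2 * α)) *
        exp (-(1 / 4 * |z| ^ α)) = (n : ℝ) ^ (-β) * G z := by rw [hG]; ring
      linarith
    · have e0 : 0 ≤ (n : ℝ) ^ (-β) * G z := mul_nonneg (by positivity) (hG0 z)
      have e1 : |secondDiff α (z / b) ^ n| ≤ q ^ (n - m) * |secondDiff α (z / b)| ^ m := by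
        rw [abs_pow, ← Nat.sub_add_cancel hnm, pow_add, Nat.add_sub_cancel]
        gcongr
        exact hfar _ hz
      have e2 : |exp (-|z| ^ α)| ≤ r ^ n * E z := by
        rw [abs_of_pos (exp_pos _), hr, hE, ← exp_nat_mul, ← exp_add]
        refine exp_le_exp.2 ?_
        have : n * ε ^ α ≤ |z| ^ α := by
          rw [← hscale z]
          gcongr
        linarith
      have := abs_sub (secondDiff α (z / b) ^ n) (exp (-|z| ^ α))
      linarith
  have hint : Integrable fun z => (n : ℝ) ^ (-β) * G z +
      q ^ (n - m) * |secondDiff α (z / b)| ^ m + r ^ n * E z :=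
    ((hGi.const_mul _).add (hρbi.const_mul _)).add (hEi.const_mul _)
  refine (integral_mono (hpi.sub hexpi).abs hint hpt).trans ?_
  rw [integral_add (by exact (hGi.const_mul _).add (hρbi.const_mul _)) (hEi.const_mul _),
    integral_add (hGi.const_mul _) (hρbi.const_mul _), integral_const_mul, integral_const_mul,
    integral_const_mul, Measure.integral_comp_div (fun z => |secondDiff α z| ^ m), smul_eq_mul,
    abs_of_pos hb0]
  have hq : q ^ (n - m) * b ≤ (n : ℝ) ^ (-β) := by
    rw [rpow_neg hn0.le, ← one_div, le_div_iff₀ (by positivity)]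
    refine le_of_mul_le_mul_right ?_ (pow_pos hq0 m)
    rw [one_mul]
    refine le_trans (le_of_eq ?_) hnq
    rw [rpow_add hn0, ← Nat.sub_add_cancel hnm, pow_add, Nat.add_sub_cancel, Nat.sub_add_cancel hnm]
    ring
  have hrn : r ^ n ≤ (n : ℝ) ^ (-β) := by
    rw [rpow_neg hn0.le, ← one_div, le_div_iff₀ (by positivity)]
    linarith
  have hn' : 0 ≤ (n : ℝ) ^ (-β) := by positivity
  nlinarith [mul_le_mul_of_nonneg_right hq hiρ, mul_le_mul_of_nonneg_right hrn hiE]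

/-- Example 1: rate of convergence in the local limit theorem for the symmetric `α`-stable
limit. With `ξ_i` i.i.d. of density `c_α(1−cos u)/|u|^{1+α}`, `S_n = (ξ_1+⋯+ξ_n)/n^{1/α}`
has (eventually) a density `p_n`, and `sup_x |p_n(x) − p(x)| ≤ C n^{−1}` for `α ∈ (0,1)`,
`≤ C n^{−(2−α)/α}` for `α ∈ [1,2)`, where `p` is the symmetric `α`-stable density. -/
theorem example_one_rate (α : ℝ) (hα : α ∈ Set.Ioo (0 : ℝ) 2) (cα : ℝ)
    (hcα : cα = (∫ t : ℝ, (1 - Real.cos t) / |t| ^ (1 + α))⁻¹)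
    (μ : Measure ℝ)
    (hμ : μ = volume.withDensity fun u => ENNReal.ofReal (cα * (1 - Real.cos u) / |u| ^ (1 + α)))
    (Pn : ℕ → Measure ℝ)
    (hPn : ∀ n : ℕ, Pn n = Measure.map (fun x => x / (n : ℝ) ^ (1 / α)) (convPow μ n))
    (p : ℝ → ℝ)
    (hp : ∀ x : ℝ, (p x : ℂ) = ((2 * π : ℝ)⁻¹ : ℂ) *
      ∫ z : ℝ, Complex.exp (-(Complex.I * (z : ℂ) * (x : ℂ)) - ((|z| ^ α : ℝ) : ℂ))) :
    ∃ pn : ℕ → ℝ → ℝ, ∃ C > 0, ∀ᶠ n in atTop,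
      Pn n = volume.withDensity (fun x => ENNReal.ofReal (pn n x)) ∧
      ∀ x : ℝ, |pn n x - p x| ≤
        C * (if α < 1 then (n : ℝ)⁻¹ else (n : ℝ) ^ (-(2 - α) / α)) := by
  obtain ⟨h0, h2⟩ := hα
  subst hcα
  obtain rfl : μ = oscMeasure α := hμ
  have hprob := isProbabilityMeasure_oscMeasure h0 h2
  have hac : oscMeasure α ≪ volume := withDensity_absolutelyContinuous _ _
  set β : ℝ := if α < 1 then 1 else (2 - α) / α with hβ
  have hβ1 : β ≤ 1 := by
    rw [hβ]; split_ifs with h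
    · exact le_rfl
    · rw [div_le_one h0]; linarith
  have hβ2 : β ≤ 2 / α - 1 := by
    rw [hβ]; split_ifs with h
    · have : 2 < 2 / α := by rw [lt_div_iff₀ h0]; linarith
      linarith
    · rw [sub_div, div_self h0.ne']
  have hrate : ∀ n : ℕ, (if α < 1 then (n : ℝ)⁻¹ else (n : ℝ) ^ (-(2 - α) / α)) =
      (n : ℝ) ^ (-β) := by
    intro n
    rw [hβ]; split_ifs
    · rw [rpow_neg_one]
    · rw [neg_div]
  obtain ⟨C, hC, hbound⟩ := exists_integral_abs_secondDiff_pow_sub_le h0 h2 hβ1 hβ2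
  refine ⟨fun n x => (((2 * π : ℝ)⁻¹ : ℂ) *
    ∫ z : ℝ, Complex.exp (-(Complex.I * (z : ℂ) * (x : ℂ))) * charFun (Pn n) z).re, C, hC, ?_⟩
  filter_upwards [hbound, eventually_ge_atTop 1] with n hn hn1
  obtain ⟨hint, hle⟩ := hn
  have hb : (n : ℝ) ^ (1 / α) ≠ 0 := (rpow_pos_of_pos (by exact_mod_cast hn1) _).ne'
  have hchar : ∀ z, charFun (Pn n) z =
      ((secondDiff α (z / (n : ℝ) ^ (1 / α)) ^ n : ℝ) : ℂ) := by
    intro z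
    rw [hPn, charFun_map_div, charFun_convPow, charFun_oscMeasure h0 h2]
    push_cast; rfl
  have hchari : Integrable (charFun (Pn n)) := by
    rw [funext hchar]; exact hint.ofReal
  have hPprob : IsProbabilityMeasure (Pn n) := by
    rw [hPn]; exact Measure.isProbabilityMeasure_map (by fun_prop)
  have hPac : Pn n ≪ volume := by
    rw [hPn]
    exact map_div_absolutelyContinuous (convPow_absolutelyContinuous hac (by omega)) hb
  refine ⟨eq_withDensity_of_integrable_charFun (Pn n) hPac hchari, fun x => ?_⟩
  have hexpi : Integrable fun z : ℝ => exp (-|z| ^ α) := by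
    simpa using integrable_abs_rpow_mul_exp_neg (s := 0) (b := 1) h0 le_rfl one_pos
  have hnorm : ∀ z : ℝ, ‖Complex.exp (-(Complex.I * (z : ℂ) * (x : ℂ)))‖ = 1 := by
    intro z
    rw [Complex.norm_exp]; simp
  have hmul : ∀ {f : ℝ → ℝ}, Integrable f → Integrable fun z : ℝ =>
      Complex.exp (-(Complex.I * (z : ℂ) * (x : ℂ))) * ((f z : ℝ) : ℂ) := fun hf =>
    hf.ofReal.bdd_mul (c := 1) (by fun_prop) (Eventually.of_forall fun z => (hnorm z).le)
  have hp' : (p x : ℂ) = ((2 * π : ℝ)⁻¹ : ℂ) *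
      ∫ z : ℝ, Complex.exp (-(Complex.I * (z : ℂ) * (x : ℂ))) * ((exp (-|z| ^ α) : ℝ) : ℂ) := by
    rw [hp]
    congr 2 with z
    rw [sub_eq_add_neg, Complex.exp_add]
    push_cast; rfl
  have hre : p x = (p x : ℂ).re := (Complex.ofReal_re _).symm
  rw [hrate, hre, hp', ← Complex.sub_re, ← mul_sub]
  simp_rw [hchar]
  rw [← integral_sub (hmul hint) (hmul hexpi)]
  refine (Complex.abs_re_le_norm _).trans ?_
  rw [norm_mul]
  have hπ : ‖((2 * π : ℝ)⁻¹ : ℂ)‖ ≤ 1 := by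
    rw [norm_inv, Complex.norm_real, norm_of_nonneg (by positivity)]
    exact inv_le_one_of_one_le₀ (by linarith [pi_gt_three])
  refine (mul_le_of_le_one_left (norm_nonneg _) hπ).trans ?_
  refine (norm_integral_le_integral_norm _).trans (le_trans (le_of_eq ?_) hle)
  congr 1 with z
  rw [← mul_sub, norm_mul, hnorm, one_mul, ← Complex.ofReal_sub, Complex.norm_real, norm_eq_abs]
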